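/- Let X be a real Hilbert space, φ : X → ℝ convex and continuous, {C_i}_{i=1}^m nonempty, closed and convex subsets of X with nonempty intersection C, let D ⊆ C be a nonempty subset of C, and let r ≥ 1 be a real number. Let {y^k}_{k=0}^∞ be any sequence generated by the superiorized DSAP algorithm with positive step-sizes {{β_{k,n}}_{n=0}^{N_k−1}}_{k=0}^∞ and arbitrary initialization y^0 ∈ X, and suppose that {y^k} converges in norm to a point y* ∈ X. If ĉ ∈ C satisfies ‖y^0 − ĉ‖ ≤ (r − 1)·Σ_{n=0}^{N_0−1} β_{0,n} and additionally d(ĉ, D) > r·Σ_{ℓ=0}^∞ Σ_{n=0}^{N_ℓ−1} β_{ℓ,n}, then y* ∉ D. -/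

import Mathlib

open scoped RealInnerProductSpace

/-- The string operator `P[t] := P_{t_q} ∘ ⋯ ∘ P_{t_1}` : the composition of the
projections indexed by the entries of the index vector `t`, applied in order. -/
def stringOp {X : Type*} {m : ℕ} (P : Fin m → X → X) (t : List (Fin m)) (x : X) : X :=
  t.foldl (fun y i => P i y) x

/-- The string-averaging operator `P_{Ω,w}(x) := Σ_{t ∈ Ω} w(t) • P[t](x)`. -/
noncomputable def strAvg {X : Type*} [NormedAddCommGroup X] [InnerProductSpace ℝ X] {m : ℕ}
    (P : Fin m → X → X) (Ω : Finset (List (Fin m))) (w : List (Fin m) → ℝ) (x : X) : X :=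
  ∑ t ∈ Ω, w t • stringOp P t x

/-- The subgradient set `∂φ(z)` of a function `φ` at a point `z`. -/
def subdiff {X : Type*} [NormedAddCommGroup X] [InnerProductSpace ℝ X]
    (φ : X → ℝ) (z : X) : Set X :=
  {s : X | ∀ y : X, φ z + ⟪s, y - z⟫ ≤ φ y}

theorem aux_proj {X : Type*} [NormedAddCommGroup X] [InnerProductSpace ℝ X]
    (K : Set X) (hK : Convex ℝ K) (x p c : X) (hp : p ∈ K)
    (h : ∀ c ∈ K, ‖x - p‖ ≤ ‖x - c‖) (hc : c ∈ K) : ‖p - c‖ ≤ ‖x - c‖ := by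
  have hinf : ‖x - p‖ = ⨅ w : K, ‖x - w‖ := by
    haveI : Nonempty K := ⟨⟨p, hp⟩⟩
    apply le_antisymm
    · exact le_ciInf fun w => h w w.2
    · exact ciInf_le ⟨0, by rintro _ ⟨w, rfl⟩; exact norm_nonneg _⟩ (⟨p, hp⟩ : K)
  have h1 := (norm_eq_iInf_iff_real_inner_le_zero hK hp).1 hinf c hc
  have h2 : ‖x - c‖ ^ 2 = ‖x - p‖ ^ 2 - 2 * ⟪x - p, c - p⟫ + ‖c - p‖ ^ 2 := by
    rw [← norm_sub_sq_real]; congr 2; abel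
  rw [norm_sub_rev p c]
  apply le_of_sq_le_sq _ (norm_nonneg _)
  nlinarith [sq_nonneg ‖x - p‖]

theorem aux_string {X : Type*} [NormedAddCommGroup X] [InnerProductSpace ℝ X] {m : ℕ}
    (P : Fin m → X → X) (c : X) (h : ∀ i x, ‖P i x - c‖ ≤ ‖x - c‖) (t : List (Fin m)) :
    ∀ x, ‖stringOp P t x - c‖ ≤ ‖x - c‖ := by
  induction t with
  | nil => intro x; simp [stringOp]
  | cons a t ih => intro x; exact (ih (P a x)).trans (h a x)

theorem aux_avg {X : Type*} [NormedAddCommGroup X] [InnerProductSpace ℝ X] {m : ℕ}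
    (P : Fin m → X → X) (c : X) (h : ∀ i x, ‖P i x - c‖ ≤ ‖x - c‖)
    (Ω : Finset (List (Fin m))) (w : List (Fin m) → ℝ) (hw : ∀ t ∈ Ω, 0 < w t)
    (hs : ∑ t ∈ Ω, w t = 1) (x : X) : ‖strAvg P Ω w x - c‖ ≤ ‖x - c‖ := by
  have e : strAvg P Ω w x - c = ∑ t ∈ Ω, w t • (stringOp P t x - c) := by
    simp only [smul_sub, Finset.sum_sub_distrib, ← Finset.sum_smul, hs, one_smul, strAvg]
  rw [e]
  calc _ ≤ ∑ t ∈ Ω, w t * ‖x - c‖ := by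
        apply norm_sum_le_of_le
        intro t ht
        rw [norm_smul, Real.norm_of_nonneg (hw t ht).le]
        exact mul_le_mul_of_nonneg_left (aux_string P c h t x) (hw t ht).le
    _ = ‖x - c‖ := by rw [← Finset.sum_mul, hs, one_mul]

theorem stmt_5
    {X : Type*} [NormedAddCommGroup X] [InnerProductSpace ℝ X] [CompleteSpace X]
    -- a convex continuous objective function
    (φ : X → ℝ) (hφconv : ConvexOn ℝ Set.univ φ) (hφcont : Continuous φ)
    {m : ℕ} (C : Fin m → Set X)
    (hCne : ∀ i, (C i).Nonempty) (hCcl : ∀ i, IsClosed (C i)) (hCcv : ∀ i, Convex ℝ (C i))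
    (hCint : (⋂ i, C i).Nonempty)
    -- a nonempty subset D of C
    (D : Set X) (hD : D ⊆ ⋂ i, C i) (hDne : D.Nonempty)
    -- `P i` is the metric projection onto `C i`
    (P : Fin m → X → X)
    (hP : ∀ i x, P i x ∈ C i ∧ ∀ c ∈ C i, ‖x - P i x‖ ≤ ‖x - c‖)
    -- (Ω_k, w_k) : finite fit sets of index vectors with positive weights summing to 1
    (Ω : ℕ → Finset (List (Fin m))) (w : ℕ → List (Fin m) → ℝ)
    (hΩne : ∀ k, ∀ t ∈ Ω k, t ≠ [])
    (hfit : ∀ k, ∀ i : Fin m, ∃ t ∈ Ω k, i ∈ t)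
    (hwpos : ∀ k, ∀ t ∈ Ω k, 0 < w k t)
    (hwsum : ∀ k, ∑ t ∈ Ω k, w k t = 1)
    -- the superiorized version of the DSAP algorithm
    (N : ℕ) (Nk : ℕ → ℕ) (hNk : ∀ k, 1 ≤ Nk k ∧ Nk k ≤ N)
    (β : ℕ → ℕ → ℝ) (hβ : ∀ k, ∀ n < Nk k, 0 < β k n ∧ β k n ≤ 1)
    (hβsum : Summable fun k => ∑ n ∈ Finset.range (Nk k), β k n)
    (y : ℕ → X) (Y : ℕ → ℕ → X) (v : ℕ → ℕ → X) (s : ℕ → ℕ → X)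
    (hY0 : ∀ k, Y k 0 = y k)
    (hs : ∀ k, ∀ n < Nk k, s k n ∈ subdiff φ (Y k n))
    (hv : ∀ k, ∀ n < Nk k,
      ((0 : X) ∉ subdiff φ (Y k n) → v k n = -(‖s k n‖⁻¹ • s k n)) ∧
      ((0 : X) ∈ subdiff φ (Y k n) → v k n = 0))
    (hYn : ∀ k, ∀ n < Nk k, Y k (n + 1) = Y k n + β k n • v k n)
    (hy : ∀ k, y (k + 1) = strAvg P (Ω k) (w k) (Y k (Nk k)))
    -- the sequence converges in norm to y*
    (ystar : X) (hconv : Filter.Tendsto y Filter.atTop (nhds ystar))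
    -- the point ĉ ∈ C and the real number r ≥ 1
    (r : ℝ) (hr : 1 ≤ r) (chat : X) (hchat : chat ∈ ⋂ i, C i)
    (hinit : ‖y 0 - chat‖ ≤ (r - 1) * ∑ n ∈ Finset.range (Nk 0), β 0 n)
    (hfar : Metric.infDist chat D > r * ∑' k : ℕ, ∑ n ∈ Finset.range (Nk k), β k n) :
    ystar ∉ D := by
  intro hmem
  have hPc : ∀ i x, ‖P i x - chat‖ ≤ ‖x - chat‖ := fun i x =>
    aux_proj (C i) (hCcv i) x _ chat (hP i x).1 (hP i x).2 (Set.mem_iInter.1 hchat i)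
  have hvn : ∀ k, ∀ n < Nk k, ‖v k n‖ ≤ 1 := by
    intro k n hn
    by_cases h0 : (0 : X) ∈ subdiff φ (Y k n)
    · rw [(hv k n hn).2 h0]; simp
    · rw [(hv k n hn).1 h0, norm_neg, norm_smul, norm_inv, norm_norm]
      exact inv_mul_le_one
  have hin : ∀ k, ∀ n ≤ Nk k,
      ‖Y k n - chat‖ ≤ ‖y k - chat‖ + ∑ j ∈ Finset.range n, β k j := by
    intro k n
    induction n with
    | zero => intro _; simp [hY0]
    | succ n ih =>
      intro hn
      have hlt : n < Nk k := hn
      have h1 := ih hlt.le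
      have hb := (hβ k n hlt).1.le
      rw [hYn k n hlt, Finset.sum_range_succ, add_sub_right_comm]
      have h2 := norm_add_le (Y k n - chat) (β k n • v k n)
      have h3 : ‖β k n • v k n‖ ≤ β k n := by
        rw [norm_smul, Real.norm_of_nonneg hb]
        exact mul_le_of_le_one_right hb (hvn k n hlt)
      linarith
  have hb0 : ∀ k, 0 ≤ ∑ n ∈ Finset.range (Nk k), β k n := fun k =>
    Finset.sum_nonneg fun n hn => (hβ k n (Finset.mem_range.1 hn)).1.le
  have hout : ∀ k, ‖y k - chat‖ ≤ ‖y 0 - chat‖ +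
      ∑ j ∈ Finset.range k, ∑ n ∈ Finset.range (Nk j), β j n := by
    intro k
    induction k with
    | zero => simp
    | succ k ih =>
      have h1 := aux_avg P chat hPc (Ω k) (w k) (hwpos k) (hwsum k) (Y k (Nk k))
      rw [← hy k] at h1
      have h2 := hin k (Nk k) le_rfl
      rw [Finset.sum_range_succ]
      linarith
  have hlim : ‖ystar - chat‖ ≤ ‖y 0 - chat‖ +
      ∑' k : ℕ, ∑ n ∈ Finset.range (Nk k), β k n := by
    refine le_of_tendsto (hconv.sub_const chat).norm (Filter.Eventually.of_forall fun k => ?_)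
    have := hβsum.sum_le_tsum (Finset.range k) (fun j _ => hb0 j)
    linarith [hout k]
  have hle : ∑ n ∈ Finset.range (Nk 0), β 0 n ≤
      ∑' k : ℕ, ∑ n ∈ Finset.range (Nk k), β k n :=
    hβsum.le_tsum 0 (fun j _ => hb0 j)
  have hd := Metric.infDist_le_dist_of_mem (x := chat) hmem
  rw [dist_comm, dist_eq_norm] at hd
  have := mul_le_mul_of_nonneg_left hle (sub_nonneg.2 hr)
  linarith
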